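/- Let p, q : [0,∞) → ℝ be functions, P ≥ 0, δ > 0 and μ > 0 constants with |p(t)| ≤ P, q(t) ≤ −δ for all t ≥ 0, and μ² + Pμ − δ ≤ 0. Let v : [0,∞) → ℝ be a bounded, twice differentiable solution of v'' + p·v' + q·v = 0 on (0,∞). Then |v(t)| ≤ |v(0)|·e^(−μt) for all t ≥ 0. -/

import Mathlib

open Set Filter Topology in
/-- Second-derivative test, necessary condition: `f'' ≤ 0` at an interior local maximum. -/
theorem IsLocalMax.deriv_deriv_nonpos {f : ℝ → ℝ} {c : ℝ} (h : IsLocalMax f c)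
    (hf : ContinuousAt f c) : deriv (deriv f) c ≤ 0 := by
  by_contra! hpos
  have hmin := isLocalMin_of_deriv_deriv_pos hpos h.deriv_eq_zero hf
  have hconst : f =ᶠ[𝓝 c] fun _ => f c := by
    filter_upwards [h, hmin] with x h₁ h₂ using le_antisymm h₁ h₂
  have hzero : deriv (deriv f) c = 0 := by
    rw [hconst.deriv.deriv_eq]
    simp
  exact hpos.ne' hzero

open Set Filter Topology in
/-- A solution of `v'' + p v' + q v = 0` bounded above on the half-line lies below the barrier
`A e^{-μt} + ε e^{μt}` as soon as it does so at the origin. -/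
theorem le_exp_barrier_of_bddAbove {p q v v' v'' : ℝ → ℝ} {P δ μ A B ε : ℝ}
    (hδ : 0 < δ) (hμ : 0 < μ) (hA : 0 ≤ A) (hε : 0 < ε)
    (hp : ∀ t, 0 ≤ t → |p t| ≤ P) (hq : ∀ t, 0 ≤ t → q t ≤ -δ)
    (hroot : μ ^ 2 + P * μ - δ ≤ 0) (hcont : ContinuousOn v (Ici 0))
    (hv' : ∀ t, 0 < t → HasDerivAt v (v' t) t)
    (hv'' : ∀ t, 0 < t → HasDerivAt v' (v'' t) t)
    (hB : ∀ t, 0 ≤ t → v t ≤ B)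
    (hode : ∀ t, 0 < t → v'' t + p t * v' t + q t * v t = 0) (hv₀ : v 0 ≤ A)
    {t : ℝ} (ht : 0 ≤ t) : v t ≤ A * Real.exp (-μ * t) + ε * Real.exp (μ * t) := by
  have hexp (a s : ℝ) : HasDerivAt (fun x => Real.exp (a * x)) (a * Real.exp (a * s)) s := by
    simpa [mul_comm] using ((hasDerivAt_id s).const_mul a).exp
  set w : ℝ → ℝ := fun s => v s - (A * Real.exp (-μ * s) + ε * Real.exp (μ * s)) with hw
  by_contra! hlt
  have hwt : 0 < w t := by simp only [hw]; linarith
  obtain ⟨T, hTB, htT⟩ : ∃ T, B ≤ ε * Real.exp (μ * T) ∧ t ≤ T := by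
    have hlim : Tendsto (fun s => ε * Real.exp (μ * s)) atTop atTop :=
      (Real.tendsto_exp_atTop.comp (tendsto_id.const_mul_atTop hμ)).const_mul_atTop hε
    exact ((hlim.eventually_ge_atTop B).and (eventually_ge_atTop t)).exists
  have hwcont : ContinuousOn w (Icc 0 T) :=
    (hcont.mono Icc_subset_Ici_self).sub (by fun_prop)
  obtain ⟨c, hc, hmax⟩ := isCompact_Icc.exists_isMaxOn ⟨t, ht, htT⟩ hwcont
  have hwc : 0 < w c := hwt.trans_le (hmax ⟨ht, htT⟩)
  have hc₀ : 0 < c := by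
    refine hc.1.lt_of_ne ?_
    rintro rfl
    simp only [hw, mul_zero, Real.exp_zero] at hwc
    linarith
  have hcT : c < T := by
    refine hc.2.lt_of_ne ?_
    rintro rfl
    have := hB c hc₀.le
    have := mul_nonneg hA (Real.exp_pos (-μ * c)).le
    simp only [hw] at hwc
    linarith
  have hw' (s : ℝ) (hs : 0 < s) : HasDerivAt w
      (v' s - (A * (-μ * Real.exp (-μ * s)) + ε * (μ * Real.exp (μ * s)))) s :=
    (hv' s hs).sub (((hexp (-μ) s).const_mul A).add ((hexp μ s).const_mul ε))
  have hw'' : HasDerivAt (deriv w)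
      (v'' c - (A * (-μ * (-μ * Real.exp (-μ * c))) + ε * (μ * (μ * Real.exp (μ * c))))) c := by
    refine HasDerivAt.congr_of_eventuallyEq ((hv'' c hc₀).sub
      ((((hexp (-μ) c).const_mul (-μ)).const_mul A).add
        (((hexp μ c).const_mul μ).const_mul ε))) ?_
    filter_upwards [Ioi_mem_nhds hc₀] with s hs using (hw' s hs).deriv
  have hlocal : IsLocalMax w c := hmax.isLocalMax (Icc_mem_nhds hc₀ hcT)
  have h₁ := hlocal.hasDerivAt_eq_zero (hw' c hc₀)
  have h₂ := hlocal.deriv_deriv_nonpos (hw' c hc₀).continuousAt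
  rw [hw''.deriv] at h₂
  have hpc := abs_le.1 (hp c hc.1)
  have hqc := hq c hc.1
  have hsuper₁ : A * Real.exp (-μ * c) * (μ ^ 2 - p c * μ + q c) ≤ 0 :=
    mul_nonpos_of_nonneg_of_nonpos (by positivity) (by nlinarith)
  have hsuper₂ : ε * Real.exp (μ * c) * (μ ^ 2 + p c * μ + q c) ≤ 0 :=
    mul_nonpos_of_nonneg_of_nonpos (by positivity) (by nlinarith)
  have hqw : q c * w c < 0 := mul_neg_of_neg_of_pos (by linarith) hwc
  have hpw := congrArg (p c * ·) h₁
  simp only [hw, mul_zero] at hqw hpw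
  linarith [hode c hc₀]

open Set Filter Topology in
/-- One-sided exponential decay of solutions of `v'' + p v' + q v = 0` bounded above on the
half-line. -/
theorem le_mul_exp_of_bddAbove {p q v v' v'' : ℝ → ℝ} {P δ μ A B : ℝ}
    (hδ : 0 < δ) (hμ : 0 < μ) (hA : 0 ≤ A)
    (hp : ∀ t, 0 ≤ t → |p t| ≤ P) (hq : ∀ t, 0 ≤ t → q t ≤ -δ)
    (hroot : μ ^ 2 + P * μ - δ ≤ 0) (hcont : ContinuousOn v (Ici 0))
    (hv' : ∀ t, 0 < t → HasDerivAt v (v' t) t)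
    (hv'' : ∀ t, 0 < t → HasDerivAt v' (v'' t) t)
    (hB : ∀ t, 0 ≤ t → v t ≤ B)
    (hode : ∀ t, 0 < t → v'' t + p t * v' t + q t * v t = 0) (hv₀ : v 0 ≤ A)
    {t : ℝ} (ht : 0 ≤ t) : v t ≤ A * Real.exp (-μ * t) := by
  refine le_of_forall_pos_le_add fun η hη => ?_
  have h := le_exp_barrier_of_bddAbove hδ hμ hA (div_pos hη (Real.exp_pos (μ * t)))
    hp hq hroot hcont hv' hv'' hB hode hv₀ ht
  rwa [div_mul_cancel₀ _ (Real.exp_pos _).ne'] at h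


/-- Half-line comparison lemma: a bounded solution on `[0,∞)` of `v'' + p v' + q v = 0` with
`q ≤ -δ < 0`, `|p| ≤ P` and `μ² + Pμ - δ ≤ 0` decays at exponential rate `μ`. -/
theorem bounded_solution_decays (p q : ℝ → ℝ) (P δ μ : ℝ)
    (hP : 0 ≤ P) (hδ : 0 < δ) (hμ : 0 < μ)
    (hp : ∀ t : ℝ, 0 ≤ t → |p t| ≤ P) (hq : ∀ t : ℝ, 0 ≤ t → q t ≤ -δ)
    (hroot : μ ^ 2 + P * μ - δ ≤ 0)
    (v : ℝ → ℝ) (hcont : ContinuousOn v (Set.Ici (0 : ℝ)))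
    (hv1 : ∀ t : ℝ, 0 < t → DifferentiableAt ℝ v t)
    (hv2 : ∀ t : ℝ, 0 < t → DifferentiableAt ℝ (deriv v) t)
    (hbdd : ∃ B : ℝ, ∀ t : ℝ, 0 ≤ t → |v t| ≤ B)
    (hode : ∀ t : ℝ, 0 < t → deriv (deriv v) t + p t * deriv v t + q t * v t = 0) :
    ∀ t : ℝ, 0 ≤ t → |v t| ≤ |v 0| * Real.exp (-μ * t) := by
  obtain ⟨B, hB⟩ := hbdd
  intro t ht
  have hv' (s : ℝ) (hs : 0 < s) := (hv1 s hs).hasDerivAt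
  have hv'' (s : ℝ) (hs : 0 < s) := (hv2 s hs).hasDerivAt
  refine abs_le'.2 ⟨?_, ?_⟩
  · exact le_mul_exp_of_bddAbove hδ hμ (abs_nonneg _) hp hq hroot hcont hv' hv''
      (fun s hs => (le_abs_self _).trans (hB s hs)) hode (le_abs_self _) ht
  · exact le_mul_exp_of_bddAbove (v := fun s => -v s) hδ hμ (abs_nonneg _) hp hq hroot hcont.neg
      (fun s hs => (hv' s hs).fun_neg) (fun s hs => (hv'' s hs).fun_neg)
      (fun s hs => (neg_le_abs _).trans (hB s hs))
      (fun s hs => by linarith [hode s hs]) (neg_le_abs _) ht
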